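/- arXiv:2409.19195 — 3 statements merged into one kernel-verified Lean document; each statement's English description precedes it below -/
import Mathlib

section
/- Let v and w be binary words such that neither is a subword of the other. Then lim_{p→0⁺} Win(v,w;p) = 1/2 if and only if ‖v‖₁ = ‖w‖₁ = r and neither O(v,w) nor O(w,v) contains a word u with ‖u‖₁ = r. -/
open scoped BigOperators

/-- Bernoulli(p) weight of a binary word `u`: `ℙ_p(u) = p^{‖u‖₁} (1-p)^{‖u‖₀}`. -/
noncomputable def wProb (p : ℝ) (u : List Bool) : ℝ :=
  p ^ (u.count true) * (1 - p) ^ (u.count false)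

/-- Number of occurrences of `v` as a contiguous subword of `u`. -/
def occCount (v u : List Bool) : ℕ :=
  (List.range (u.length + 1)).countP (fun i => decide (v <+: u.drop i))

/-- `Ω_{v,w}(v)`: binary words having `v` as a suffix, containing `v` exactly once
as a subword, and not containing `w` as a subword.  (`Ω_{v,w}(w) = OmegaWin w v`.) -/
def OmegaWin (v w : List Bool) : Set (List Bool) :=
  {u | v <:+ u ∧ occCount v u = 1 ∧ ¬ (w <:+: u)}

/-- The win probability `Win(v,w;p) = ∑_{u ∈ Ω_{v,w}(v)} ℙ_p(u)`. -/
noncomputable def Win (v w : List Bool) (p : ℝ) : ℝ :=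
  ∑' u : OmegaWin v w, wProb p u

/-- The correlation polynomial `vw_p = ∑_{u ∈ O(v,w)} ℙ_p(u)⁻¹`, where `O(v,w)` is
the set of nonempty words that are simultaneously a suffix of `v` and a prefix of `w`. -/
noncomputable def corr (v w : List Bool) (p : ℝ) : ℝ :=
  ∑ i ∈ Finset.Icc 1 w.length,
    if w.take i <:+ v then (wProb p (w.take i))⁻¹ else 0

/-- `Ω*_{v,w}(v) = {x : x ++ v ∈ Ω_{v,w}(v)}` (with `x` possibly empty). -/
def OmegaStarV (v w : List Bool) : Set (List Bool) :=
  {x | x ++ v ∈ OmegaWin v w}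

/-- Property `R`: `Ω*_{v,w}(v) = Ω*_{v,w}(w)`. -/
def PropR (v w : List Bool) : Prop :=
  OmegaStarV v w = {x | x ++ w ∈ OmegaWin w v}

/-- `D(v,w)`: nonempty proper prefixes `v₁⋯v_{n-k}` of `v` (`1 ≤ k ≤ n-1`) such that
`w₁⋯w_k = v_{n-k+1}⋯v_n`. -/
def Dset (v w : List Bool) : Set (List Bool) :=
  {x | ∃ k, 1 ≤ k ∧ k ≤ v.length - 1 ∧ k ≤ w.length ∧
    x = v.take (v.length - k) ∧ w.take k = v.drop (v.length - k)}

/-- `F(v,w) = D(v,v) ∪ D(w,w) ∪ D(w,v) ∪ D(v,w)`. -/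
def Fset (v w : List Bool) : Set (List Bool) :=
  Dset v v ∪ Dset w w ∪ Dset w v ∪ Dset v w

/-- `a^m`: concatenation of `m` copies of the word `a`. -/
def wpow (a : List Bool) (m : ℕ) : List Bool :=
  (List.replicate m a).flatten

open scoped ENNReal

/-- The minimal words, in the prefix order, outside `S`. -/
def exitSet (S : Set (List Bool)) : Set (List Bool) :=
  {u | u ∉ S ∧ ∀ y, y <+: u → y ≠ u → y ∈ S}

theorem append_singleton_mem_exitSet {S : Set (List Bool)}
    (hS : ∀ x y, x <+: y → y ∈ S → x ∈ S) (x : List Bool) (b : Bool) :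
    x ++ [b] ∈ exitSet S ↔ x ++ [b] ∉ S ∧ x ∈ S := by
  refine and_congr_right fun _ => ⟨fun h => h x (List.prefix_append _ _) (by simp), ?_⟩
  intro hx y hy hne
  rcases List.prefix_concat_iff.1 hy with h | h
  · exact absurd h hne
  · exact hS _ _ h hx

/-- A word is either empty or obtained from a word by appending a letter. -/
def optionSnocEquiv : Option (List Bool × Bool) ≃ List Bool where
  toFun o := o.elim [] fun q => q.1 ++ [q.2]
  invFun u := u.getLast?.map fun b => (u.dropLast, b)
  left_inv o := by rcases o with _ | ⟨x, b⟩ <;> simp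
  right_inv u := by
    rcases List.eq_nil_or_concat u with rfl | ⟨x, b, rfl⟩ <;> simp

theorem tsum_list_eq_snoc (f : List Bool → ℝ≥0∞) :
    ∑' u, f u = f [] + ∑' x, (f (x ++ [true]) + f (x ++ [false])) := by
  classical
  rw [← optionSnocEquiv.tsum_eq, ENNReal.tsum_eq_add_tsum_ite none,
    ← (Option.some_injective (List Bool × Bool)).tsum_eq, ENNReal.tsum_prod']
  · simp [optionSnocEquiv, add_comm]
  · rintro (_ | q) hq
    · simp at hq
    · exact ⟨q, rfl⟩

section Weight

variable {μ : List Bool → ℝ≥0∞} {S : Set (List Bool)}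

theorem tsum_indicator_add_exitSet (hμ : ∀ x y, μ (x ++ y) = μ x * μ y) (hnil : μ [] = 1)
    (hsum : μ [true] + μ [false] = 1)
    (hS : ∀ x y, x <+: y → y ∈ S → x ∈ S) (hS₀ : [] ∈ S) :
    ∑' u, S.indicator μ u + ∑' u, (exitSet S).indicator μ u = 1 + ∑' u, S.indicator μ u := by
  classical
  have key (x : List Bool) (b : Bool) :
      S.indicator μ (x ++ [b]) + (exitSet S).indicator μ (x ++ [b]) =
        S.indicator μ x * μ [b] := by
    have h := append_singleton_mem_exitSet hS x b
    have h' := hS x (x ++ [b]) (List.prefix_append _ _)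
    by_cases h₁ : x ∈ S <;> by_cases h₂ : x ++ [b] ∈ S <;>
      simp_all
  rw [← ENNReal.tsum_add, tsum_list_eq_snoc]
  congr 1
  · simp [exitSet, hS₀, hnil]
  · refine tsum_congr fun x => ?_
    rw [key, key, ← mul_add, hsum, mul_one]

theorem tsum_exitSet_eq_one (hμ : ∀ x y, μ (x ++ y) = μ x * μ y) (hnil : μ [] = 1)
    (hsum : μ [true] + μ [false] = 1)
    (hS : ∀ x y, x <+: y → y ∈ S → x ∈ S) (hS₀ : [] ∈ S)
    (hfin : ∑' u, S.indicator μ u ≠ ∞) :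
    ∑' u, (exitSet S).indicator μ u = 1 := by
  have h := tsum_indicator_add_exitSet hμ hnil hsum hS hS₀
  rw [add_comm 1] at h
  exact (ENNReal.add_right_inj hfin).1 h

theorem tsum_exitSet_le_one (hμ : ∀ x y, μ (x ++ y) = μ x * μ y) (hnil : μ [] = 1)
    (hsum : μ [true] + μ [false] = 1) (htop : ∀ x, μ x ≠ ∞)
    (hS : ∀ x y, x <+: y → y ∈ S → x ∈ S) (hS₀ : [] ∈ S) :
    ∑' u, (exitSet S).indicator μ u ≤ 1 := by
  rw [ENNReal.tsum_eq_iSup_sum]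
  refine iSup_le fun s => ?_
  set n := s.sup List.length
  set T : Set (List Bool) := S ∩ {x | x.length ≤ n}
  have hT : T.Finite := (List.finite_length_le Bool n).subset Set.inter_subset_right
  have hfin : ∑' u, T.indicator μ u ≠ ∞ := by
    rw [tsum_eq_sum (s := hT.toFinset) fun u hu => by
      rw [Set.indicator_of_notMem]; simpa using hu]
    exact ENNReal.sum_ne_top.2 fun u _ =>
      ((Set.indicator_le_self' (fun _ _ => zero_le) u).trans_lt (htop u).lt_top).ne
  rw [← tsum_exitSet_eq_one hμ hnil hsum (S := T)
    (fun x y hxy hy => ⟨hS x y hxy hy.1, hxy.length_le.trans hy.2⟩) ⟨hS₀, by simp⟩ hfin]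
  refine (Finset.sum_le_sum fun u hu => ?_).trans (ENNReal.sum_le_tsum s)
  by_cases huS : u ∈ exitSet S
  · have hle : u.length ≤ n := Finset.le_sup (f := List.length) hu
    have : u ∈ exitSet T :=
      ⟨fun h => huS.1 h.1, fun y hy hne => ⟨huS.2 y hy hne, hy.length_le.trans hle⟩⟩
    simp [huS, this]
  · simp [huS]

theorem tsum_append (g : List Bool → ℝ≥0∞) (t : List Bool) :
    ∑' x, g (x ++ t) = ∑' y, {y | t <:+ y}.indicator g y := by
  rw [← (List.append_left_injective t).tsum_eq (f := {y | t <:+ y}.indicator g)]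
  · exact tsum_congr fun x => by simp
  · intro y hy
    obtain ⟨x, hx⟩ : t <:+ y := by
      by_contra h
      exact hy (by simp [h])
    exact ⟨x, hx⟩

theorem sum_exitSet_append_take (hμ : ∀ x y, μ (x ++ y) = μ x * μ y)
    (hS : ∀ x y, x <+: y → y ∈ S → x ∈ S) (t : List Bool) (ht : ∀ x, x ++ t ∉ S)
    (x : List Bool) :
    ∑ k ∈ Finset.Icc 1 t.length, (exitSet S).indicator μ (x ++ t.take k) * μ (t.drop k) =
      S.indicator μ x * μ t := by
  classical
  by_cases hx : x ∈ S
  · have hex : ∃ k, x ++ t.take k ∉ S := ⟨t.length, by simpa using ht x⟩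
    set k := Nat.find hex with hk
    have hkS : x ++ t.take k ∉ S := Nat.find_spec hex
    have hk1 : 1 ≤ k := by
      by_contra h
      have : k = 0 := by omega
      rw [this] at hkS
      simp [hx] at hkS
    have hkt : k ≤ t.length := Nat.find_le (by simpa using ht x)
    have hkH : x ++ t.take k ∈ exitSet S := by
      refine ⟨hkS, fun y hy hne => ?_⟩
      rcases List.prefix_or_prefix_of_prefix hy (List.prefix_append x _) with h | ⟨z, rfl⟩
      · exact hS _ _ h hx
      · have hz := (List.prefix_append_right_inj x).1 hy
        have hzl := hz.length_le
        have hzt : z = t.take z.length :=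
          List.prefix_iff_eq_take.1 (hz.trans (List.take_prefix _ _))
        have : z.length < k := by
          rcases lt_or_ge z.length k with h | h
          · exact h
          · exact absurd (by rw [hz.eq_of_length_le (by simp; omega)]) hne
        have := Nat.find_min hex this
        rw [hzt]
        simpa using this
    rw [Finset.sum_eq_single_of_mem k (Finset.mem_Icc.2 ⟨hk1, hkt⟩)]
    · rw [Set.indicator_of_mem hkH, Set.indicator_of_mem hx, hμ, mul_assoc, ← hμ,
        List.take_append_drop]
    · intro j hj hjk
      rw [Set.indicator_of_notMem, zero_mul]
      intro hjH
      have hjt := (Finset.mem_Icc.1 hj).2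
      rcases lt_or_gt_of_ne hjk with h | h
      · exact Nat.find_min hex h hjH.1
      · refine hkS (hjH.2 _ ?_ ?_)
        · exact (List.prefix_append_right_inj x).2
            (List.take_prefix_take_left h.le)
        · intro he
          have := congrArg List.length he
          simp at this
          omega
  · rw [Set.indicator_of_notMem hx, zero_mul]
    refine Finset.sum_eq_zero fun k hk => ?_
    rw [Set.indicator_of_notMem, zero_mul]
    have hk := Finset.mem_Icc.1 hk
    refine fun h => hx (h.2 x (List.prefix_append _ _) fun he => ?_)
    have := congrArg List.length he
    rw [List.length_append, List.length_take] at this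
    omega

theorem tsum_indicator_mul (hμ : ∀ x y, μ (x ++ y) = μ x * μ y)
    (hS : ∀ x y, x <+: y → y ∈ S → x ∈ S) (t : List Bool) (ht : ∀ x, x ++ t ∉ S) :
    (∑' x, S.indicator μ x) * μ t = ∑ k ∈ Finset.Icc 1 t.length,
      (∑' y, {y | t.take k <:+ y}.indicator ((exitSet S).indicator μ) y) * μ (t.drop k) := by
  rw [← ENNReal.tsum_mul_right]
  simp_rw [← sum_exitSet_append_take hμ hS t ht]
  rw [Summable.tsum_finsetSum fun _ _ => ENNReal.summable]
  refine Finset.sum_congr rfl fun k _ => ?_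
  rw [ENNReal.tsum_mul_right, tsum_append]

end Weight

/-- The words in which neither `v` nor `w` occurs. -/
def avoiding (v w : List Bool) : Set (List Bool) := {x | ¬ v <:+: x ∧ ¬ w <:+: x}

theorem avoiding_comm (v w : List Bool) : avoiding v w = avoiding w v :=
  Set.ext fun _ => and_comm

theorem avoiding_prefix_closed (v w x y : List Bool) (hxy : x <+: y) (hy : y ∈ avoiding v w) :
    x ∈ avoiding v w :=
  ⟨fun h => hy.1 (h.trans hxy.isInfix), fun h => hy.2 (h.trans hxy.isInfix)⟩

theorem occCount_append_singleton_eq_one_iff {v x : List Bool} {b : Bool} (hv : v ≠ [])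
    (h : v <:+ x ++ [b]) : occCount v (x ++ [b]) = 1 ↔ ¬ v <:+: x := by
  have hcard : occCount v (x ++ [b]) = ((Finset.range ((x ++ [b]).length + 1)).filter
      fun i => v <+: (x ++ [b]).drop i).card := by
    rw [occCount, List.countP_eq_length_filter]
    rfl
  have hpos := List.length_pos_iff.2 hv
  have hle := h.length_le
  have hlen : (x ++ [b]).length = x.length + 1 := by simp
  set i₀ := (x ++ [b]).length - v.length with hi₀
  have hmem : i₀ ∈ (Finset.range ((x ++ [b]).length + 1)).filter
      fun i => v <+: (x ++ [b]).drop i := by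
    refine Finset.mem_filter.2 ⟨Finset.mem_range.2 (by omega), ?_⟩
    rw [← List.suffix_iff_eq_drop.1 h]
  rw [hcard]
  constructor
  · rintro h₁ ⟨s, t, rfl⟩
    obtain ⟨a, ha⟩ := Finset.card_eq_one.1 h₁
    have hs : s.length ∈ (Finset.range ((s ++ v ++ t ++ [b]).length + 1)).filter
        fun i => v <+: (s ++ v ++ t ++ [b]).drop i := by
      refine Finset.mem_filter.2 ⟨Finset.mem_range.2 (by simp), ?_⟩
      simp [List.append_assoc]
    rw [ha, Finset.mem_singleton] at hs hmem
    simp at hi₀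
    omega
  · intro hx
    refine Finset.card_eq_one.2 ⟨i₀, Finset.eq_singleton_iff_unique_mem.2 ⟨hmem, fun i hi => ?_⟩⟩
    have hi := (Finset.mem_filter.1 hi).2
    have hil := hi.length_le
    rw [List.length_drop] at hil
    rw [List.drop_append_of_le_length (by omega)] at hi
    rcases List.prefix_concat_iff.1 hi with h' | h'
    · have := congrArg List.length h'
      simp at this
      omega
    · exact absurd (h'.isInfix.trans (List.drop_suffix i x).isInfix) hx

theorem mem_OmegaWin_iff {v w : List Bool} (hv : v ≠ [])
    (hvw : ¬ v <:+: w) (hwv : ¬ w <:+: v) (u : List Bool) :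
    u ∈ OmegaWin v w ↔ u ∈ exitSet (avoiding v w) ∧ v <:+ u := by
  rcases List.eq_nil_or_concat u with rfl | ⟨x, b, rfl⟩
  · simp [OmegaWin, hv]
  rw [List.concat_eq_append] at *
  rw [append_singleton_mem_exitSet (avoiding_prefix_closed v w)]
  constructor
  · rintro ⟨hvu, hocc, hwu⟩
    refine ⟨⟨fun h => h.1 hvu.isInfix, ?_, ?_⟩, hvu⟩
    · exact (occCount_append_singleton_eq_one_iff hv hvu).1 hocc
    · exact fun h => hwu (h.trans (List.prefix_append _ _).isInfix)
  · rintro ⟨⟨-, hvx, hwx⟩, hvu⟩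
    refine ⟨hvu, (occCount_append_singleton_eq_one_iff hv hvu).2 hvx, fun h => ?_⟩
    rcases List.infix_concat_iff.1 h with h | h
    · rcases List.suffix_or_suffix_of_suffix h hvu with h | h
      · exact hwv h.isInfix
      · exact hvw h.isInfix
    · exact hwx h

theorem exitSet_avoiding_indicator {v w : List Bool} (hv : v ≠ []) (hw : w ≠ [])
    (hvw : ¬ v <:+: w) (hwv : ¬ w <:+: v) (μ : List Bool → ℝ≥0∞) (u : List Bool) :
    (exitSet (avoiding v w)).indicator μ u =
      (OmegaWin v w).indicator μ u + (OmegaWin w v).indicator μ u := by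
  classical
  have h₁ := mem_OmegaWin_iff hv hvw hwv u
  have h₂ := mem_OmegaWin_iff hw hwv hvw u
  rw [avoiding_comm w v] at h₂
  have h₃ : u ∈ exitSet (avoiding v w) → v <:+ u ∨ w <:+ u := by
    rcases List.eq_nil_or_concat u with rfl | ⟨x, b, rfl⟩
    · exact fun h => absurd ⟨by simpa using hv, by simpa using hw⟩ h.1
    rw [List.concat_eq_append, append_singleton_mem_exitSet (avoiding_prefix_closed v w)]
    rintro ⟨h, hx⟩
    by_contra! hne
    refine h ⟨fun h => ?_, fun h => ?_⟩
    · exact (List.infix_concat_iff.1 h).elim hne.1 hx.1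
    · exact (List.infix_concat_iff.1 h).elim hne.2 hx.2
  have h₄ : ¬ (v <:+ u ∧ w <:+ u) := fun h =>
    (List.suffix_or_suffix_of_suffix h.1 h.2).elim (fun h => hvw h.isInfix)
      fun h => hwv h.isInfix
  simp only [Set.indicator_apply]
  split_ifs <;> simp_all

theorem tsum_suffix_indicator_OmegaWin {v w s : List Bool} (hs : v <:+: s → v = s)
    (μ : List Bool → ℝ≥0∞) :
    ∑' y, {y | s <:+ y}.indicator ((OmegaWin v w).indicator μ) y =
      if s <:+ v then ∑' y, (OmegaWin v w).indicator μ y else 0 := by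
  classical
  split_ifs with h
  · refine tsum_congr fun y => ?_
    simp only [Set.indicator_apply, Set.mem_ofPred_eq]
    split_ifs with h₁ h₂ h₂ <;> try rfl
    exact absurd (h.trans h₂.1) h₁
  · refine ENNReal.tsum_eq_zero.2 fun y => ?_
    simp only [Set.indicator_apply, Set.mem_ofPred_eq]
    split_ifs with h₁ h₂ <;> try rfl
    rcases List.suffix_or_suffix_of_suffix h₁ h₂.1 with h' | h'
    · exact absurd h' h
    · exact absurd (hs h'.isInfix ▸ List.suffix_refl _) h

/-- The correlation polynomial of `a` and `t` multiplied by `wProb p t`. -/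
noncomputable def scaledCorr (a t : List Bool) (p : ℝ) : ℝ :=
  ∑ k ∈ Finset.Icc 1 t.length, if t.take k <:+ a then wProb p (t.drop k) else 0

theorem wProb_append (p : ℝ) (x y : List Bool) : wProb p (x ++ y) = wProb p x * wProb p y := by
  simp only [wProb, List.count_append, pow_add]
  ring

theorem wProb_pos {p : ℝ} (hp : p ∈ Set.Ioo (0 : ℝ) 1) (x : List Bool) : 0 < wProb p x :=
  mul_pos (pow_pos hp.1 _) (pow_pos (sub_pos.2 hp.2) _)

theorem scaledCorr_nonneg {p : ℝ} (hp : p ∈ Set.Ioo (0 : ℝ) 1) (a t : List Bool) :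
    0 ≤ scaledCorr a t p :=
  Finset.sum_nonneg fun k _ => by
    split_ifs
    · exact (wProb_pos hp _).le
    · exact le_rfl

theorem ofReal_scaledCorr {p : ℝ} (hp : p ∈ Set.Ioo (0 : ℝ) 1) (a t : List Bool) :
    ENNReal.ofReal (scaledCorr a t p) = ∑ k ∈ Finset.Icc 1 t.length,
      if t.take k <:+ a then ENNReal.ofReal (wProb p (t.drop k)) else 0 := by
  rw [scaledCorr, ENNReal.ofReal_sum_of_nonneg]
  · exact Finset.sum_congr rfl fun k _ => by split_ifs <;> simp
  · intro k _
    split_ifs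
    · exact (wProb_pos hp _).le
    · exact le_rfl

theorem Win_eq_toReal {p : ℝ} (hp : p ∈ Set.Ioo (0 : ℝ) 1) (v w : List Bool) :
    Win v w p =
      (∑' u, (OmegaWin v w).indicator (fun u => ENNReal.ofReal (wProb p u)) u).toReal := by
  rw [← tsum_subtype, ENNReal.tsum_toReal_eq fun _ => ENNReal.ofReal_ne_top, Win]
  exact tsum_congr fun u => (ENNReal.toReal_ofReal (wProb_pos hp _).le).symm

theorem tsum_avoiding_mul {v w t : List Bool} (hv : v ≠ []) (hw : w ≠ [])
    (hvw : ¬ v <:+: w) (hwv : ¬ w <:+: v) {p : ℝ} (hp : p ∈ Set.Ioo (0 : ℝ) 1)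
    (ht : t = v ∨ t = w) :
    (∑' u, (avoiding v w).indicator (fun u => ENNReal.ofReal (wProb p u)) u) *
        ENNReal.ofReal (wProb p t) =
      (∑' u, (OmegaWin v w).indicator (fun u => ENNReal.ofReal (wProb p u)) u) *
          ENNReal.ofReal (scaledCorr v t p) +
        (∑' u, (OmegaWin w v).indicator (fun u => ENNReal.ofReal (wProb p u)) u) *
          ENNReal.ofReal (scaledCorr w t p) := by
  have hinf {a : List Bool} (ha : a <:+: t → a = t) (k : ℕ) :
      a <:+: t.take k → a = t.take k := by
    intro h
    obtain rfl := ha (h.trans (List.take_prefix k t).isInfix)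
    exact h.eq_of_length_le (by simp)
  have htv : v <:+: t → v = t := by
    rcases ht with rfl | rfl
    · exact fun _ => rfl
    · exact fun h => absurd h hvw
  have htw : w <:+: t → w = t := by
    rcases ht with rfl | rfl
    · exact fun h => absurd h hwv
    · exact fun _ => rfl
  have htS (x : List Bool) : x ++ t ∉ avoiding v w := by
    rcases ht with rfl | rfl
    · exact fun h => h.1 (List.suffix_append _ _).isInfix
    · exact fun h => h.2 (List.suffix_append _ _).isInfix
  rw [tsum_indicator_mul (μ := fun u => ENNReal.ofReal (wProb p u)) (S := avoiding v w)
    (fun x y => by rw [wProb_append, ENNReal.ofReal_mul (wProb_pos hp x).le])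
    (avoiding_prefix_closed v w) t htS, ofReal_scaledCorr hp, ofReal_scaledCorr hp,
    Finset.mul_sum, Finset.mul_sum, ← Finset.sum_add_distrib]
  refine Finset.sum_congr rfl fun k _ => ?_
  rw [show (exitSet (avoiding v w)).indicator (fun u => ENNReal.ofReal (wProb p u)) =
    (OmegaWin v w).indicator (fun u => ENNReal.ofReal (wProb p u)) +
      (OmegaWin w v).indicator (fun u => ENNReal.ofReal (wProb p u)) from
    funext (exitSet_avoiding_indicator hv hw hvw hwv _), Set.indicator_add']
  simp only [Pi.add_apply]
  rw [ENNReal.tsum_add, tsum_suffix_indicator_OmegaWin (hinf htv k),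
    tsum_suffix_indicator_OmegaWin (hinf htw k), add_mul]
  congr 1 <;> split_ifs <;> simp

theorem Win_add_Win_and_scaledCorr {v w : List Bool} (hv : v ≠ []) (hw : w ≠ [])
    (hvw : ¬ v <:+: w) (hwv : ¬ w <:+: v) {p : ℝ} (hp : p ∈ Set.Ioo (0 : ℝ) 1) :
    Win v w p + Win w v p = 1 ∧
      wProb p w * (Win v w p * scaledCorr v v p + Win w v p * scaledCorr w v p) =
        wProb p v * (Win v w p * scaledCorr v w p + Win w v p * scaledCorr w w p) := by
  set μ : List Bool → ℝ≥0∞ := fun u => ENNReal.ofReal (wProb p u) with hμdef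
  have hμ (x y : List Bool) : μ (x ++ y) = μ x * μ y := by
    simp only [hμdef, wProb_append, ENNReal.ofReal_mul (wProb_pos hp x).le]
  have hnil : μ [] = 1 := by simp [hμdef, wProb]
  have hsum : μ [true] + μ [false] = 1 := by
    rw [hμdef, ← ENNReal.ofReal_add (wProb_pos hp _).le (wProb_pos hp _).le]
    simp [wProb]
  have hS₀ : [] ∈ avoiding v w := ⟨by simpa using hv, by simpa using hw⟩
  have hexit : ∑' u, (exitSet (avoiding v w)).indicator μ u =
      ∑' u, (OmegaWin v w).indicator μ u + ∑' u, (OmegaWin w v).indicator μ u := by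
    rw [← ENNReal.tsum_add]
    exact tsum_congr (exitSet_avoiding_indicator hv hw hvw hwv μ)
  have hle := tsum_exitSet_le_one hμ hnil hsum (fun _ => ENNReal.ofReal_ne_top)
    (avoiding_prefix_closed v w) hS₀
  rw [hexit] at hle
  have hv_top : ∑' u, (OmegaWin v w).indicator μ u ≠ ∞ :=
    ne_top_of_le_ne_top ENNReal.one_ne_top (le_self_add.trans hle)
  have hw_top : ∑' u, (OmegaWin w v).indicator μ u ≠ ∞ :=
    ne_top_of_le_ne_top ENNReal.one_ne_top (le_add_self.trans hle)
  have heq {t : List Bool} (ht : t = v ∨ t = w) := tsum_avoiding_mul hv hw hvw hwv hp ht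
  have hfin : ∑' u, (avoiding v w).indicator μ u ≠ ∞ := by
    intro htop
    have h := heq (.inl rfl)
    rw [htop, ENNReal.top_mul (by simpa using wProb_pos hp v)] at h
    exact ENNReal.add_ne_top.2 ⟨ENNReal.mul_ne_top hv_top ENNReal.ofReal_ne_top,
      ENNReal.mul_ne_top hw_top ENNReal.ofReal_ne_top⟩ h.symm
  have hreal {t : List Bool} (ht : t = v ∨ t = w) :
      (∑' u, (avoiding v w).indicator μ u).toReal * wProb p t =
        Win v w p * scaledCorr v t p + Win w v p * scaledCorr w t p := by
    have h := congrArg ENNReal.toReal (heq ht)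
    rw [ENNReal.toReal_add (ENNReal.mul_ne_top hv_top ENNReal.ofReal_ne_top)
      (ENNReal.mul_ne_top hw_top ENNReal.ofReal_ne_top)] at h
    simp only [ENNReal.toReal_mul, ENNReal.toReal_ofReal (wProb_pos hp _).le,
      ENNReal.toReal_ofReal (scaledCorr_nonneg hp _ _)] at h
    rwa [Win_eq_toReal hp, Win_eq_toReal hp]
  constructor
  · rw [Win_eq_toReal hp, Win_eq_toReal hp, ← ENNReal.toReal_add hv_top hw_top, ← hexit,
      tsum_exitSet_eq_one hμ hnil hsum (avoiding_prefix_closed v w) hS₀ hfin, ENNReal.toReal_one]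
  · rw [← hreal (.inl rfl), ← hreal (.inr rfl)]
    ring

/-- Some word in `O(a, t)` contains as many letters `true` as `t`. -/
def HasFullOverlap (a t : List Bool) : Prop :=
  ∃ u : List Bool, u ≠ [] ∧ u <:+ a ∧ u <+: t ∧ u.count true = t.count true

theorem eq_of_suffix_of_prefix_of_count {u₁ u₂ : List Bool} (hs : u₁ <:+ u₂) (hp : u₁ <+: u₂)
    (hpos : 1 ≤ u₁.count true) (hcount : u₁.count true = u₂.count true) : u₁ = u₂ := by
  obtain ⟨s, rfl⟩ := hs
  obtain ⟨t, ht⟩ := hp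
  have hu : true ∈ u₁ := List.one_le_count_iff.1 hpos
  have hs : true ∉ s := by
    rw [List.count_append] at hcount
    exact List.count_eq_zero.1 (by omega)
  have h := congrArg (List.idxOf true) ht
  rw [List.idxOf_append_of_mem hu, List.idxOf_append_of_notMem hs] at h
  obtain rfl : s = [] := List.length_eq_zero_iff.1 (by omega)
  rfl

theorem wProb_zero (x : List Bool) : wProb 0 x = if x.count true = 0 then 1 else 0 := by
  simp [wProb, zero_pow_eq]

theorem scaledCorr_zero {a t : List Bool} (ht : 1 ≤ t.count true)
    [Decidable (HasFullOverlap a t)] :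
    scaledCorr a t 0 = if HasFullOverlap a t then 1 else 0 := by
  have hdrop (k : ℕ) : (t.drop k).count true = 0 ↔ (t.take k).count true = t.count true := by
    have := congrArg (List.count true) (List.take_append_drop k t)
    rw [List.count_append] at this
    omega
  simp only [scaledCorr, wProb_zero, hdrop]
  split_ifs with h
  · obtain ⟨u, hne, hsuf, hpre, hcount⟩ := h
    have hu := List.prefix_iff_eq_take.1 hpre
    rw [Finset.sum_eq_single_of_mem u.length
      (Finset.mem_Icc.2 ⟨List.length_pos_iff.2 hne, hpre.length_le⟩)]
    · rw [← hu, if_pos hsuf, if_pos hcount]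
    · intro k hk hku
      split_ifs with h₁ h₂ <;> try rfl
      have hk := Finset.mem_Icc.1 hk
      refine absurd ?_ hku
      have hlen : (t.take k).length = k := by simp [hk.2]
      rw [← hlen]
      rcases List.suffix_or_suffix_of_suffix h₁ hsuf with hs | hs
      · have hp := List.prefix_of_prefix_length_le (List.take_prefix k t) hpre hs.length_le
        rw [eq_of_suffix_of_prefix_of_count hs hp (by omega) (by omega)]
      · have hp := List.prefix_of_prefix_length_le hpre (List.take_prefix k t) hs.length_le
        rw [← eq_of_suffix_of_prefix_of_count hs hp (by omega) (by omega)]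
  · refine Finset.sum_eq_zero fun k hk => ?_
    split_ifs with h₁ h₂ <;> try rfl
    have hk := Finset.mem_Icc.1 hk
    exact absurd ⟨t.take k, List.ne_nil_of_length_pos (by simp; omega), h₁,
      List.take_prefix k t, h₂⟩ h

theorem hasFullOverlap_self {t : List Bool} (ht : t ≠ []) : HasFullOverlap t t :=
  ⟨t, ht, List.suffix_refl t, List.prefix_refl t, rfl⟩

theorem HasFullOverlap.count_le {a t : List Bool} (h : HasFullOverlap a t) :
    t.count true ≤ a.count true := by
  obtain ⟨u, -, hs, -, hc⟩ := h
  exact hc ▸ hs.sublist.count_le true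

theorem HasFullOverlap.idxOf_le {a t : List Bool} (h : HasFullOverlap a t)
    (ht : 1 ≤ t.count true) (hat : a.count true = t.count true) :
    a.idxOf true ≥ t.idxOf true ∧ (a.idxOf true = t.idxOf true → a <+: t) := by
  obtain ⟨u, -, ⟨s, rfl⟩, ⟨z, rfl⟩, hc⟩ := h
  have hu : true ∈ u := List.one_le_count_iff.1 (by omega)
  have hs : true ∉ s := by
    rw [List.count_append] at hat
    exact List.count_eq_zero.1 (by omega)
  rw [List.idxOf_append_of_mem hu, List.idxOf_append_of_notMem hs]
  refine ⟨by omega, fun h => ?_⟩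
  obtain rfl : s = [] := List.length_eq_zero_iff.1 (by omega)
  exact List.prefix_append _ _

theorem not_hasFullOverlap_and_swap {v w : List Bool} (hvw : ¬ v <:+: w)
    (hcount : v.count true = w.count true) (hpos : 1 ≤ w.count true) :
    ¬ (HasFullOverlap v w ∧ HasFullOverlap w v) := by
  rintro ⟨h₁, h₂⟩
  have h₁ := h₁.idxOf_le hpos hcount
  have h₂ := h₂.idxOf_le (by omega) hcount.symm
  exact hvw (h₁.2 (le_antisymm h₂.1 h₁.1)).isInfix

theorem continuous_scaledCorr (a t : List Bool) : Continuous (scaledCorr a t) := by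
  refine continuous_finsetSum _ fun k _ => ?_
  split_ifs
  · unfold wProb
    fun_prop
  · exact continuous_const

open Filter Topology in
theorem tendsto_Win {v w : List Bool} (hv : v ≠ []) (hw : w ≠ [])
    (hvw : ¬ v <:+: w) (hwv : ¬ w <:+: v) (hle : v.count true ≤ w.count true) {f g : ℝ}
    (hf : 0 ^ (w.count true - v.count true) * scaledCorr v v 0 - scaledCorr v w 0 = f)
    (hg : scaledCorr w w 0 - 0 ^ (w.count true - v.count true) * scaledCorr w v 0 = g)
    (hfg : f + g ≠ 0) :
    Tendsto (fun p => Win v w p) (𝓝[>] 0) (𝓝 (g / (f + g))) := by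
  set d := w.count true - v.count true with hd
  let F (p : ℝ) := p ^ d * (1 - p) ^ w.count false * scaledCorr v v p -
    (1 - p) ^ v.count false * scaledCorr v w p
  let G (p : ℝ) := (1 - p) ^ v.count false * scaledCorr w w p -
    p ^ d * (1 - p) ^ w.count false * scaledCorr w v p
  have hFc : Continuous F := by
    have := continuous_scaledCorr v v
    have := continuous_scaledCorr v w
    fun_prop
  have hGc : Continuous G := by
    have := continuous_scaledCorr w w
    have := continuous_scaledCorr w v
    fun_prop
  have hF : Tendsto F (𝓝[>] 0) (𝓝 f) := by
    have h := hFc.tendsto 0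
    simp only [F, sub_zero, one_pow, mul_one, one_mul, hf] at h
    exact h.mono_left nhdsWithin_le_nhds
  have hG : Tendsto G (𝓝[>] 0) (𝓝 g) := by
    have h := hGc.tendsto 0
    simp only [G, sub_zero, one_pow, mul_one, one_mul, hg] at h
    exact h.mono_left nhdsWithin_le_nhds
  refine (hG.div (hF.add hG) hfg).congr' ?_
  filter_upwards [Ioo_mem_nhdsGT (zero_lt_one (α := ℝ)), (hF.add hG).eventually_ne hfg]
    with p hp hne
  obtain ⟨h₁, h₂⟩ := Win_add_Win_and_scaledCorr hv hw hvw hwv hp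
  have hwp : wProb p w = p ^ v.count true * (p ^ d * (1 - p) ^ w.count false) := by
    rw [wProb, ← mul_assoc, ← pow_add, hd, Nat.add_sub_cancel' hle]
  rw [hwp, wProb] at h₂
  simp only [mul_assoc] at h₂
  have h₃ := mul_left_cancel₀ (pow_pos hp.1 _).ne' h₂
  rw [← eq_sub_iff_add_eq'] at h₁
  rw [h₁] at h₃
  rw [Pi.div_apply, div_eq_iff hne]
  simp only [F, G]
  linear_combination -h₃

open Filter Topology in
theorem tendsto_Win_one {v w : List Bool} (hv : v ≠ []) (hw : w ≠ [])
    (hvw : ¬ v <:+: w) (hwv : ¬ w <:+: v) (hlt : v.count true < w.count true) :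
    Tendsto (fun p => Win v w p) (𝓝[>] 0) (𝓝 1) := by
  classical
  have hd : w.count true - v.count true ≠ 0 := by omega
  have h := tendsto_Win hv hw hvw hwv hlt.le (f := 0) (g := 1) ?_ ?_ (by norm_num)
  · simpa using h
  · rw [zero_pow hd, scaledCorr_zero (a := v) (t := w) (by omega),
      if_neg fun h => absurd h.count_le (by omega)]
    simp
  · rw [zero_pow hd, scaledCorr_zero (by omega), if_pos (hasFullOverlap_self hw)]
    simp

theorem one_le_count_true {v w : List Bool} (hvw : ¬ v <:+: w) (hwv : ¬ w <:+: v)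
    (hcount : v.count true = w.count true) : 1 ≤ w.count true := by
  by_contra! h
  have hrep {x : List Bool} (hx : x.count true = 0) : x = List.replicate x.length false :=
    List.eq_replicate_iff.2 ⟨rfl, fun b hb => by
      cases b
      · rfl
      · exact absurd hb (List.count_eq_zero.1 hx)⟩
  have hv := hrep (x := v) (by omega)
  have hw := hrep (x := w) (by omega)
  rcases le_total v.length w.length with hl | hl
  · refine hvw ⟨[], List.replicate (w.length - v.length) false, ?_⟩
    rw [hv, hw]
    simp [hl]
  · refine hwv ⟨[], List.replicate (v.length - w.length) false, ?_⟩
    rw [hv, hw]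
    simp [hl]

/-- Characterization of when `lim_{p→0⁺} Win(v,w;p) = 1/2`: both words have the same
number of 1s, say `r`, and neither `O(v,w)` nor `O(w,v)` contains a word with `r` 1s. -/
theorem stmt8 (v w : List Bool) (hv : v ≠ []) (hw : w ≠ [])
    (hvw : ¬ v <:+: w) (hwv : ¬ w <:+: v) :
    Filter.Tendsto (fun p => Win v w p) (nhdsWithin 0 (Set.Ioi 0)) (nhds (1/2)) ↔
      (v.count true = w.count true ∧
        (∀ u : List Bool, u ≠ [] → u <:+ v → u <+: w → u.count true ≠ v.count true) ∧
        (∀ u : List Bool, u ≠ [] → u <:+ w → u <+: v → u.count true ≠ v.count true)) := by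
  classical
  have hvw_iff (hc : v.count true = w.count true) :
      (∀ u : List Bool, u ≠ [] → u <:+ v → u <+: w → u.count true ≠ v.count true) ↔
        ¬ HasFullOverlap v w := by
    simp only [HasFullOverlap, hc]
    push Not
    rfl
  have hwv_iff : (∀ u : List Bool, u ≠ [] → u <:+ w → u <+: v → u.count true ≠ v.count true) ↔
      ¬ HasFullOverlap w v := by
    simp only [HasFullOverlap]
    push Not
    rfl
  rcases lt_trichotomy (v.count true) (w.count true) with hlt | heq | hgt
  · refine iff_of_false (fun h => ?_) fun h => hlt.ne h.1
    have := tendsto_nhds_unique h (tendsto_Win_one hv hw hvw hwv hlt)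
    norm_num at this
  · have hpos := one_le_count_true hvw hwv heq
    have hnot := not_hasFullOverlap_and_swap hvw heq hpos
    have hlim := tendsto_Win hv hw hvw hwv heq.le rfl rfl
    rw [scaledCorr_zero hpos, scaledCorr_zero (heq ▸ hpos),
      scaledCorr_zero hpos, scaledCorr_zero (heq ▸ hpos),
      if_pos (hasFullOverlap_self hv), if_pos (hasFullOverlap_self hw),
      heq, Nat.sub_self, pow_zero] at hlim
    rw [hvw_iff heq, hwv_iff]
    have hlim_iff {c : ℝ} (h : Filter.Tendsto (fun p => Win v w p)
        (nhdsWithin 0 (Set.Ioi 0)) (nhds c)) :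
        Filter.Tendsto (fun p => Win v w p) (nhdsWithin 0 (Set.Ioi 0)) (nhds (1 / 2)) ↔
          c = 1 / 2 :=
      ⟨fun h' => tendsto_nhds_unique h h', fun hc => hc ▸ h⟩
    by_cases h₁ : HasFullOverlap v w <;> by_cases h₂ : HasFullOverlap w v
    · exact absurd ⟨h₁, h₂⟩ hnot
    all_goals
      simp only [h₁, h₂, if_true, if_false] at hlim
      rw [hlim_iff (hlim (by norm_num))]
      norm_num [h₁, h₂, heq]
  · refine iff_of_false (fun h => ?_) fun h => hgt.ne' h.1
    have hev : (fun p => 1 - Win w v p) =ᶠ[nhdsWithin 0 (Set.Ioi 0)] fun p => Win v w p := by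
      filter_upwards [Ioo_mem_nhdsGT (zero_lt_one (α := ℝ))] with p hp
      linarith [(Win_add_Win_and_scaledCorr hv hw hvw hwv hp).1]
    have := tendsto_nhds_unique h
      (((tendsto_Win_one hw hv hwv hvw hgt).const_sub 1).congr' hev)
    norm_num at this
end

section
/- Let (v,w) be a pair of distinct binary words of the same length. Then (v,w) has property R if and only if for every f ∈ F(v,w), neither fv nor fw belongs to Ω_{v,w} (where fv, fw denote concatenations). -/
open scoped BigOperators

theorem occCount_append_self_eq_one_iff (a x : List Bool) :
    occCount a (x ++ a) = 1 ↔ ∀ i < x.length, ¬ a <+: (x ++ a).drop i := by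
  have hsplit : (x ++ a).length + 1 = x.length + (1 + a.length) := by
    rw [List.length_append]; ring
  have htail : ((List.range a.length).map (x.length + 1 + ·)).countP
      (fun i => decide (a <+: (x ++ a).drop i)) = 0 := by
    simp only [List.countP_eq_zero, List.mem_map, List.mem_range, decide_eq_true_eq]
    rintro _ ⟨j, hj, rfl⟩ h
    have := h.length_le
    simp only [List.length_drop, List.length_append] at this
    omega
  unfold occCount
  rw [hsplit, ← add_assoc, List.range_add, List.range_succ, List.countP_append,
    List.countP_append, htail]
  simp [List.countP_eq_zero]

theorem infix_iff_exists_prefix_drop (b u : List Bool) :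
    b <:+: u ↔ ∃ i, b <+: u.drop i := by
  constructor
  · rintro ⟨s, t, rfl⟩
    exact ⟨s.length, t, by simp⟩
  · rintro ⟨i, h⟩
    exact h.isInfix.trans (List.drop_suffix i u).isInfix

/-- Of two distinct words of equal length, the first wins at `x ++ a` iff neither of them
starts at a position inside `x`. -/
theorem append_mem_OmegaWin_iff {a b : List Bool} (hne : a ≠ b) (hlen : a.length = b.length)
    (x : List Bool) :
    x ++ a ∈ OmegaWin a b ↔
      ∀ i < x.length, ¬ a <+: x.drop i ++ a ∧ ¬ b <+: x.drop i ++ a := by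
  have hdrop : ∀ i < x.length, (x ++ a).drop i = x.drop i ++ a := fun i hi =>
    List.drop_append_of_le_length hi.le
  simp only [OmegaWin, Set.mem_ofPred_eq, List.suffix_append, true_and,
    occCount_append_self_eq_one_iff, infix_iff_exists_prefix_drop, not_exists]
  constructor
  · rintro ⟨h₁, h₂⟩ i hi
    rw [← hdrop i hi]
    exact ⟨h₁ i hi, h₂ i⟩
  · refine fun h => ⟨fun i hi => hdrop i hi ▸ (h i hi).1, fun i hb => ?_⟩
    have hle := hb.length_le
    simp only [List.length_drop, List.length_append] at hle
    rcases lt_trichotomy i x.length with hi | rfl | hi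
    · exact (h i hi).2 (hdrop i hi ▸ hb)
    · rw [List.drop_left] at hb
      exact hne (hb.eq_of_length hlen.symm).symm
    · have ha : a = [] := List.length_eq_zero_iff.mp (by omega)
      have hb' : b = [] := List.length_eq_zero_iff.mp (by rw [← hlen, ha]; rfl)
      exact hne (ha.trans hb'.symm)

theorem drop_append_mem_OmegaWin {a b : List Bool} (hne : a ≠ b) (hlen : a.length = b.length)
    {x : List Bool} (hx : x ++ a ∈ OmegaWin a b) (i : ℕ) :
    x.drop i ++ a ∈ OmegaWin a b := by
  rw [append_mem_OmegaWin_iff hne hlen] at hx ⊢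
  intro j hj
  rw [List.length_drop] at hj
  rw [List.drop_drop]
  exact hx (i + j) (by omega)

/-- `Dset c b` consists of the nonempty words `f` shorter than `c` such that `c` is a prefix
of `f ++ b`. -/
theorem mem_Dset_iff {c b : List Bool} (hlen : c.length = b.length) (f : List Bool) :
    f ∈ Dset c b ↔ 0 < f.length ∧ f.length < c.length ∧ c <+: f ++ b := by
  constructor
  · rintro ⟨k, hk₁, hk₂, hk₃, rfl, hk⟩
    refine ⟨by simp; omega, by simp; omega, b.drop k, ?_⟩
    conv_lhs => rw [← List.take_append_drop (c.length - k) c, ← hk]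
    rw [List.append_assoc, List.take_append_drop]
  · rintro ⟨h₁, h₂, hc⟩
    refine ⟨c.length - f.length, by omega, by omega, by omega, ?_⟩
    rw [Nat.sub_sub_self h₂.le]
    obtain ⟨g, rfl⟩ : f <+: c :=
      List.prefix_of_prefix_length_le (List.prefix_append f b) hc h₂.le
    have hg : g <+: b := (List.prefix_append_right_inj f).mp hc
    simpa using (List.prefix_iff_eq_take.mp hg).symm

theorem exists_mem_Dset_of_mem_of_notMem {a b x : List Bool} (hne : a ≠ b)
    (hlen : a.length = b.length) (hx : x ++ a ∈ OmegaWin a b) (hx' : x ++ b ∉ OmegaWin b a) :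
    ∃ f ∈ Dset a b ∪ Dset b b, f ++ a ∈ OmegaWin a b := by
  have hwin := hx
  rw [append_mem_OmegaWin_iff hne hlen] at hx
  rw [append_mem_OmegaWin_iff hne.symm hlen.symm] at hx'
  push Not at hx'
  obtain ⟨i, hi, h⟩ := hx'
  have hpos : 0 < (x.drop i).length := by rw [List.length_drop]; omega
  have hshort : ∀ c : List Bool, c <+: x.drop i ++ b → ¬ c <+: x.drop i ++ a →
      (x.drop i).length < c.length := by
    intro c hc hc'
    by_contra hle
    exact hc' ((List.prefix_of_prefix_length_le hc (List.prefix_append _ b)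
      (not_lt.mp hle)).trans (List.prefix_append _ _))
  refine ⟨x.drop i, ?_, drop_append_mem_OmegaWin hne hlen hwin i⟩
  by_cases hb : b <+: x.drop i ++ b
  · exact Or.inr ((mem_Dset_iff rfl _).mpr ⟨hpos, hshort b hb (hx i hi).2, hb⟩)
  · have ha := h hb
    exact Or.inl ((mem_Dset_iff hlen _).mpr ⟨hpos, hshort a ha (hx i hi).1, ha⟩)

theorem append_notMem_OmegaWin_of_mem_Dset {a b f : List Bool} (hne : a ≠ b)
    (hlen : a.length = b.length) (hf : f ∈ Dset a b ∪ Dset b b) :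
    f ++ b ∉ OmegaWin b a := by
  rw [append_mem_OmegaWin_iff hne.symm hlen.symm]
  intro h
  rcases hf with hf | hf
  · obtain ⟨hpos, -, hp⟩ := (mem_Dset_iff hlen f).mp hf
    exact (h 0 hpos).2 hp
  · obtain ⟨hpos, -, hp⟩ := (mem_Dset_iff rfl f).mp hf
    exact (h 0 hpos).1 hp

theorem append_notMem_OmegaWin (a b f : List Bool) : f ++ a ∉ OmegaWin b a :=
  fun h => h.2.2 (List.suffix_append f a).isInfix

/-- Property `R` holds iff no bad prefix `f ∈ F(v,w)` yields `fv` or `fw` in `Ω_{v,w}`. -/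
theorem stmt11 (v w : List Bool) (hv : v ≠ []) (hne : v ≠ w)
    (hlen : v.length = w.length) :
    PropR v w ↔
      ∀ f ∈ Fset v w,
        (f ++ v) ∉ (OmegaWin v w ∪ OmegaWin w v) ∧
        (f ++ w) ∉ (OmegaWin v w ∪ OmegaWin w v) := by
  constructor
  · intro hR f hf
    have hiff : f ++ v ∈ OmegaWin v w ↔ f ++ w ∈ OmegaWin w v := Set.ext_iff.mp hR f
    have hboth : f ++ v ∉ OmegaWin v w ∧ f ++ w ∉ OmegaWin w v := by
      rcases hf with ((hf | hf) | hf) | hf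
      · have := append_notMem_OmegaWin_of_mem_Dset hne.symm hlen.symm (Or.inr hf)
        exact ⟨this, mt hiff.mpr this⟩
      · have := append_notMem_OmegaWin_of_mem_Dset hne hlen (Or.inr hf)
        exact ⟨mt hiff.mp this, this⟩
      · have := append_notMem_OmegaWin_of_mem_Dset hne.symm hlen.symm (Or.inl hf)
        exact ⟨this, mt hiff.mpr this⟩
      · have := append_notMem_OmegaWin_of_mem_Dset hne hlen (Or.inl hf)
        exact ⟨mt hiff.mp this, this⟩
    exact ⟨fun h => h.elim hboth.1 (append_notMem_OmegaWin v w f),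
      fun h => h.elim (append_notMem_OmegaWin w v f) hboth.2⟩
  · intro h
    ext x
    constructor
    · intro hx
      by_contra hx'
      obtain ⟨f, hf, hfv⟩ := exists_mem_Dset_of_mem_of_notMem hne hlen hx hx'
      refine (h f ?_).1 (Or.inl hfv)
      rcases hf with hf | hf <;> simp [Fset, hf]
    · intro hx
      by_contra hx'
      obtain ⟨f, hf, hfw⟩ := exists_mem_Dset_of_mem_of_notMem hne.symm hlen.symm hx hx'
      refine (h f ?_).2 (Or.inr hfw)
      rcases hf with hf | hf <;> simp [Fset, hf]
end

section
/- Let v = 1100 and w = 1010. Then there exists a bijection φ: Ω_{v,w}(v) → Ω_{v,w}(v) such that ‖φ(x)‖₁ = ‖x‖₀ and ‖φ(x)‖₀ = ‖x‖₁ for every x ∈ Ω_{v,w}(v); equivalently ℙ_p(φ(x)) = ℙ_{1−p}(x) for all p ∈ (0,1). In particular, Win(v,w;p) = Win(v,w;1−p) for all p ∈ (0,1). -/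
open scoped BigOperators

theorem occCount_cons (v : List Bool) (a : Bool) (u : List Bool) :
    occCount v (a :: u) = (if v <+: a :: u then 1 else 0) + occCount v u := by
  unfold occCount
  rw [List.length_cons, List.range_succ_eq_map, List.countP_cons, List.countP_map, add_comm]
  simp [Function.comp_def]

theorem occCount_eq_zero_iff (v u : List Bool) : occCount v u = 0 ↔ ¬ v <:+: u := by
  induction u with
  | nil => simp [occCount]
  | cons a u ih =>
    rw [occCount_cons, List.infix_cons_iff, Nat.add_eq_zero_iff, ih]
    simp

/-- `1100` has no border, so a new occurrence cannot straddle the junction. -/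
theorem prefix_cons_append_iff_v (a : Bool) (y : List Bool) :
    [true, true, false, false] <+: a :: (y ++ [true, true, false, false]) ↔
      [true, true, false, false] <+: a :: y := by
  rcases y with _ | ⟨b, _ | ⟨c, _ | ⟨d, y⟩⟩⟩ <;> simp

/-- No proper nonempty suffix of `1010` is a prefix of `1100`. -/
theorem prefix_cons_append_iff_w (a : Bool) (y : List Bool) :
    [true, false, true, false] <+: a :: (y ++ [true, true, false, false]) ↔
      [true, false, true, false] <+: a :: y := by
  rcases y with _ | ⟨b, _ | ⟨c, _ | ⟨d, y⟩⟩⟩ <;> simp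

theorem occCount_append_v (y : List Bool) :
    occCount [true, true, false, false] (y ++ [true, true, false, false]) =
      occCount [true, true, false, false] y + 1 := by
  induction y with
  | nil => decide
  | cons a y ih =>
    rw [List.cons_append, occCount_cons, occCount_cons, ih]
    simp only [prefix_cons_append_iff_v]
    ring

theorem infix_append_v_iff (y : List Bool) :
    [true, false, true, false] <:+: y ++ [true, true, false, false] ↔
      [true, false, true, false] <:+: y := by
  induction y with
  | nil => decide
  | cons a y ih =>
    rw [List.cons_append, List.infix_cons_iff, List.infix_cons_iff, ih, prefix_cons_append_iff_w]

theorem append_v_mem_OmegaWin_iff (y : List Bool) :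
    y ++ [true, true, false, false] ∈
        OmegaWin [true, true, false, false] [true, false, true, false] ↔
      ¬ [true, true, false, false] <:+: y ∧ ¬ [true, false, true, false] <:+: y := by
  simp [OmegaWin, occCount_append_v, infix_append_v_iff, occCount_eq_zero_iff]

/-- The reverse complement of a binary word. -/
def revCompl (y : List Bool) : List Bool :=
  (y.map not).reverse

theorem revCompl_revCompl (y : List Bool) : revCompl (revCompl y) = y := by
  simp [revCompl, Function.comp_def]

theorem infix_revCompl_of_infix {v y : List Bool} (h : v <:+: y) : revCompl v <:+: revCompl y :=
  (h.map not).reverse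

theorem infix_revCompl_iff {v y : List Bool} : v <:+: revCompl y ↔ revCompl v <:+: y :=
  ⟨fun h => by simpa only [revCompl_revCompl] using infix_revCompl_of_infix h,
    fun h => by simpa only [revCompl_revCompl] using infix_revCompl_of_infix h⟩

theorem count_revCompl (b : Bool) (y : List Bool) : (revCompl y).count b = y.count (!b) := by
  induction y with
  | nil => rfl
  | cons a y ih =>
    rw [revCompl, List.count_reverse] at ih ⊢
    cases a <;> cases b <;> simp_all

/-- Replace the part of a word preceding its last four letters, which should be `1100`,
by its reverse complement. -/
def revComplInit (x : List Bool) : List Bool :=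
  revCompl (x.rdrop 4) ++ [true, true, false, false]

theorem revComplInit_append (y : List Bool) :
    revComplInit (y ++ [true, true, false, false]) =
      revCompl y ++ [true, true, false, false] := by
  simp [revComplInit, List.rdrop]

theorem revComplInit_mem {x : List Bool}
    (hx : x ∈ OmegaWin [true, true, false, false] [true, false, true, false]) :
    revComplInit x ∈ OmegaWin [true, true, false, false] [true, false, true, false] := by
  obtain ⟨y, rfl⟩ := hx.1
  rw [append_v_mem_OmegaWin_iff] at hx
  rw [revComplInit_append, append_v_mem_OmegaWin_iff, infix_revCompl_iff, infix_revCompl_iff]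
  exact hx

theorem revComplInit_revComplInit {x : List Bool} (hx : [true, true, false, false] <:+ x) :
    revComplInit (revComplInit x) = x := by
  obtain ⟨y, rfl⟩ := hx
  simp only [revComplInit_append, revCompl_revCompl]

theorem count_revComplInit {x : List Bool} (hx : [true, true, false, false] <:+ x) (b : Bool) :
    (revComplInit x).count b = x.count (!b) := by
  obtain ⟨y, rfl⟩ := hx
  rw [revComplInit_append, List.count_append, List.count_append, count_revCompl]
  cases b <;> rfl

theorem wProb_revComplInit {x : List Bool} (hx : [true, true, false, false] <:+ x) (p : ℝ) :
    wProb p (revComplInit x) = wProb (1 - p) x := by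
  simp only [wProb, count_revComplInit hx, Bool.not_true, Bool.not_false, sub_sub_cancel]
  exact mul_comm _ _

/-- The involution of `Ω_{v,w}(v)` induced by `revComplInit`. -/
def revComplEquiv :
    OmegaWin [true, true, false, false] [true, false, true, false] ≃
      OmegaWin [true, true, false, false] [true, false, true, false] :=
  Function.Involutive.toPerm (fun x => ⟨revComplInit x, revComplInit_mem x.2⟩)
    fun x => Subtype.ext (revComplInit_revComplInit x.2.1)

/-- For `v = 1100`, `w = 1010`: there is a bijection of `Ω_{v,w}(v)` with itself swapping
the number of 0s and 1s; in particular the pair has even symmetry. -/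
theorem stmt15 :
    (∃ φ : OmegaWin [true, true, false, false] [true, false, true, false] →
           OmegaWin [true, true, false, false] [true, false, true, false],
      Function.Bijective φ ∧
      (∀ x, (φ x : List Bool).count true = (x : List Bool).count false ∧
            (φ x : List Bool).count false = (x : List Bool).count true) ∧
      (∀ x, ∀ p ∈ Set.Ioo (0:ℝ) 1,
        wProb p (φ x : List Bool) = wProb (1 - p) (x : List Bool))) ∧
    (∀ p ∈ Set.Ioo (0:ℝ) 1,
      Win [true, true, false, false] [true, false, true, false] p =
        Win [true, true, false, false] [true, false, true, false] (1 - p)) := by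
  refine ⟨⟨revComplEquiv, revComplEquiv.bijective, fun x => ?_, fun x p _ => ?_⟩, fun p _ => ?_⟩
  · exact ⟨count_revComplInit x.2.1 true, count_revComplInit x.2.1 false⟩
  · exact wProb_revComplInit x.2.1 p
  · unfold Win
    rw [← revComplEquiv.tsum_eq]
    exact tsum_congr fun x => wProb_revComplInit x.2.1 p
end
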